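/- Let k ≥ 1 and N > k be integers, let q ≥ N+1, and let c : Finset (Fin q) → ℕ satisfy conditions (i), (iii) and (iv) of the abstract codimension setup. Then every nonempty subset Γ ⊆ Fin q with c(Γ) ≤ k satisfies #Γ ≤ N and c(Γ) ≥ #Γ − (N−k). -/

import Mathlib

/-- A subadditive set function that is `0` on the empty set and at most `1` on singletons is
bounded by the cardinality. -/
theorem Finset.le_card_of_subadditive {α : Type*} [DecidableEq α] (c : Finset α → ℕ)
    (hempty : c ∅ = 0) (hsingle : ∀ i, c {i} ≤ 1)
    (hsubadd : ∀ s t : Finset α, c (s ∪ t) ≤ c s + c t) (s : Finset α) : c s ≤ s.card := by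
  induction s using Finset.induction_on with
  | empty => simp [hempty]
  | insert a s ha ih =>
    rw [Finset.card_insert_of_notMem ha, Finset.insert_eq]
    have h := hsubadd {a} s
    have h1 := hsingle a
    omega

/-- Under conditions (i), (iii), (iv) of the abstract codimension setup, every nonempty
`Γ` with `c Γ ≤ k` has at most `N` elements and satisfies `c Γ ≥ #Γ − (N−k)`. -/
theorem abstract_codim_card_bounds (k N q : ℕ) (hk : 1 ≤ k) (hNk : k < N) (hq : N + 1 ≤ q)
    (c : Finset (Fin q) → ℕ)
    (hempty : c ∅ = 0) (hsingle : ∀ i : Fin q, c {i} = 1)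
    (hsubadd : ∀ Γ Γ' : Finset (Fin q), c (Γ ∪ Γ') ≤ c Γ + c Γ')
    (hsubgen : ∀ Γ : Finset (Fin q), N + 1 ≤ Γ.card → c Γ = k + 1)
    (Γ : Finset (Fin q)) (hne : Γ.Nonempty) (hcΓ : c Γ ≤ k) :
    Γ.card ≤ N ∧ (Γ.card : ℤ) - ((N : ℤ) - (k : ℤ)) ≤ (c Γ : ℤ) := by
  have hcard : Γ.card ≤ N := by
    by_contra! h
    have := hsubgen Γ h
    omega
  refine ⟨hcard, ?_⟩
  obtain ⟨Δ, hΓΔ, hΔ⟩ := Finset.exists_superset_card_eq (s := Γ) (n := N + 1)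
    (by omega) (by simpa using hq)
  have hcΔ := hsubgen Δ hΔ.ge
  have hsum := hsubadd Γ (Δ \ Γ)
  rw [Finset.union_sdiff_of_subset hΓΔ] at hsum
  have hdiff := Finset.le_card_of_subadditive c hempty (fun i => (hsingle i).le) hsubadd (Δ \ Γ)
  rw [Finset.card_sdiff_of_subset hΓΔ] at hdiff
  omega
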